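/- arXiv:1010.0161 — 3 statements merged into one kernel-verified Lean document; each statement's English description precedes it below -/
import Mathlib

section
/- Let ι be a countable index set, let κ ≥ 0 and let (λ_i)_{i ∈ ι} be real numbers with inf_{i ∈ ι}(κ + λ_i) > 0, let (b_i)_{i ∈ ι} be real numbers, and let γ > 0 be such that Σ_{i ∈ ι} b_i² (κ + λ_i)^{2γ−1} < ∞. Set δ := min(γ, 1/2). Then there exists a constant C > 0 such that for every t ∈ [0,1] one has Σ_{i ∈ ι} b_i² ∫₀^t e^{−2λ_i s} ds ≤ C · t^{2δ}. -/
open scoped ENNReal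

theorem aux_integral_bound (κ l t θ : ℝ) (hκ : 0 ≤ κ) (hl : 0 < κ + l) (ht0 : 0 ≤ t) (ht1 : t ≤ 1)
    (hθ0 : 0 ≤ θ) (hθ1 : θ ≤ 1) :
    ∫ s in (0 : ℝ)..t, Real.exp (-2 * l * s) ≤
      Real.exp (2 * κ) * (t ^ θ * (κ + l) ^ (θ - 1)) := by
  set m := κ + l with hm
  set J := ∫ s in (0 : ℝ)..t, Real.exp ((-2 * m) * s) with hJ
  have h1 : ∫ s in (0 : ℝ)..t, Real.exp (-2 * l * s) ≤ Real.exp (2 * κ) * J := by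
    rw [hJ, ← intervalIntegral.integral_const_mul]
    apply intervalIntegral.integral_mono_on ht0
    · exact Continuous.intervalIntegrable (by fun_prop) _ _
    · exact Continuous.intervalIntegrable (by fun_prop) _ _
    · intro s hs
      rw [← Real.exp_add]
      apply Real.exp_le_exp.mpr
      have : κ * s ≤ κ * 1 := mul_le_mul_of_nonneg_left (hs.2.trans ht1) hκ
      rw [hm]
      nlinarith
  have hJ0 : 0 ≤ J := intervalIntegral.integral_nonneg ht0 (fun s _ => (Real.exp_pos _).le)
  have hJt : J ≤ t := by
    have : J ≤ ∫ s in (0 : ℝ)..t, (1 : ℝ) := by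
      apply intervalIntegral.integral_mono_on ht0
      · exact Continuous.intervalIntegrable (by fun_prop) _ _
      · exact Continuous.intervalIntegrable (by fun_prop) _ _
      · intro s hs
        apply Real.exp_le_one_iff.mpr
        nlinarith [mul_nonneg hl.le hs.1]
    simpa using this
  have hJm : J ≤ m⁻¹ := by
    have hne : (-2 * m) ≠ 0 := by
      apply mul_ne_zero (by norm_num) hl.ne'
    have e : J = (1 - Real.exp (-2 * m * t)) * (m⁻¹ / 2) := by
      rw [hJ, intervalIntegral.integral_comp_mul_left (fun x => Real.exp x) hne, integral_exp]
      simp only [mul_zero, Real.exp_zero, smul_eq_mul]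
      have := hl.ne'
      field_simp
      ring
    rw [e]
    have hp := Real.exp_pos (-2 * m * t)
    have hi : 0 < m⁻¹ := inv_pos.mpr hl
    nlinarith [mul_pos hp hi]
  refine h1.trans (mul_le_mul_of_nonneg_left ?_ (Real.exp_pos _).le)
  have e1 : J = J ^ θ * J ^ (1 - θ) := by
    rw [← Real.rpow_add_of_nonneg hJ0 hθ0 (by linarith)]
    simp
  have e2 : m ^ (θ - 1) = (m⁻¹) ^ (1 - θ) := by
    rw [Real.inv_rpow hl.le, ← Real.rpow_neg hl.le]
    congr 1
    ring
  rw [e1, e2]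
  exact mul_le_mul (Real.rpow_le_rpow hJ0 hJt hθ0) (Real.rpow_le_rpow hJ0 hJm (by linarith))
    (Real.rpow_nonneg hJ0 _) (Real.rpow_nonneg ht0 _)

/-- **Simultaneously diagonalizable case, temporal regularity** (Section 5.3 of the paper).
Let `ι` be countable, `κ ≥ 0`, `(λ_i)` reals with `inf_i (κ + λ_i) > 0`, `(b_i)` reals
and `γ > 0` with `Σ_i b_i² (κ+λ_i)^{2γ−1} < ∞`.  Set `δ := min(γ, 1/2)`.  Then there is a
constant `C > 0` such that `Σ_i b_i² ∫₀^t e^{−2λ_i s} ds ≤ C t^{2δ}` for all `t ∈ [0,1]`. -/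
theorem diagonalizable_stochastic_convolution_bound
    {ι : Type*} [Countable ι] (κ : ℝ) (hκ : 0 ≤ κ)
    (lam : ι → ℝ) (hlam : ∃ ε > 0, ∀ i, ε ≤ κ + lam i)
    (b : ι → ℝ) (γ : ℝ) (hγ : 0 < γ)
    (hsum : (∑' i, ENNReal.ofReal (b i ^ 2 * (κ + lam i) ^ (2 * γ - 1))) < ⊤)
    (δ : ℝ) (hδ : δ = min γ (1 / 2)) :
    ∃ C > 0, ∀ t ∈ Set.Icc (0 : ℝ) 1,
      (∑' i, ENNReal.ofReal (b i ^ 2 * ∫ s in (0 : ℝ)..t, Real.exp (-2 * lam i * s)))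
        ≤ ENNReal.ofReal (C * t ^ (2 * δ)) := by
  obtain ⟨ε, hε, hle⟩ := hlam
  have hδγ : δ ≤ γ := hδ ▸ min_le_left _ _
  have hδh : δ ≤ 1 / 2 := hδ ▸ min_le_right _ _
  have hδ0 : 0 < δ := hδ ▸ lt_min hγ (by norm_num)
  set S := ∑' i, ENNReal.ofReal (b i ^ 2 * (κ + lam i) ^ (2 * γ - 1)) with hS
  have hA : 0 < Real.exp (2 * κ) * ε ^ (2 * δ - 2 * γ) :=
    mul_pos (Real.exp_pos _) (Real.rpow_pos_of_pos hε _)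
  have hS0 : 0 ≤ S.toReal := ENNReal.toReal_nonneg
  refine ⟨Real.exp (2 * κ) * ε ^ (2 * δ - 2 * γ) * (S.toReal + 1),
    mul_pos hA (by linarith), ?_⟩
  rintro t ⟨ht0, ht1⟩
  have htd : 0 ≤ t ^ (2 * δ) := Real.rpow_nonneg ht0 _
  set D := Real.exp (2 * κ) * ε ^ (2 * δ - 2 * γ) * t ^ (2 * δ) with hD
  have hD0 : 0 ≤ D := mul_nonneg hA.le htd
  have key : ∀ i, ENNReal.ofReal (b i ^ 2 * ∫ s in (0 : ℝ)..t, Real.exp (-2 * lam i * s)) ≤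
      ENNReal.ofReal D * ENNReal.ofReal (b i ^ 2 * (κ + lam i) ^ (2 * γ - 1)) := by
    intro i
    rw [← ENNReal.ofReal_mul hD0]
    apply ENNReal.ofReal_le_ofReal
    have hm : 0 < κ + lam i := hε.trans_le (hle i)
    have h1 := aux_integral_bound κ (lam i) t (2 * δ) hκ hm ht0 ht1 (by linarith) (by linarith)
    have h2 : (κ + lam i) ^ (2 * δ - 1) ≤
        ε ^ (2 * δ - 2 * γ) * (κ + lam i) ^ (2 * γ - 1) := by
      have e : (κ + lam i) ^ (2 * δ - 1) =
          (κ + lam i) ^ (2 * δ - 2 * γ) * (κ + lam i) ^ (2 * γ - 1) := by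
        rw [← Real.rpow_add hm]
        congr 1
        ring
      rw [e]
      exact mul_le_mul_of_nonneg_right
        (Real.rpow_le_rpow_of_nonpos hε (hle i) (by linarith)) (Real.rpow_nonneg hm.le _)
    calc b i ^ 2 * ∫ s in (0 : ℝ)..t, Real.exp (-2 * lam i * s)
        ≤ b i ^ 2 * (Real.exp (2 * κ) * (t ^ (2 * δ) *
            (ε ^ (2 * δ - 2 * γ) * (κ + lam i) ^ (2 * γ - 1)))) := by
          refine mul_le_mul_of_nonneg_left (h1.trans ?_) (sq_nonneg _)
          exact mul_le_mul_of_nonneg_left (mul_le_mul_of_nonneg_left h2 htd) (Real.exp_pos _).le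
      _ = D * (b i ^ 2 * (κ + lam i) ^ (2 * γ - 1)) := by
          rw [hD]
          ring
  refine (ENNReal.tsum_le_tsum key).trans ?_
  rw [ENNReal.tsum_mul_left, ← hS, ← ENNReal.ofReal_toReal hsum.ne, ← ENNReal.ofReal_mul hD0]
  apply ENNReal.ofReal_le_ofReal
  rw [ENNReal.toReal_ofReal hS0]
  calc D * S.toReal ≤ D * (S.toReal + 1) := mul_le_mul_of_nonneg_left (by linarith) hD0
    _ = _ := by
      rw [hD]
      ring
end

section
/- Let ι be a countable index set, let κ ≥ 0 and let (λ_i)_{i ∈ ι} be real numbers with κ + λ_i > 0 for every i ∈ ι, let (b_i)_{i ∈ ι} be real numbers with Σ_{i ∈ ι} b_i² < ∞, let r ∈ [0, 1/2) and T > 0. Then Σ_{i ∈ ι} b_i² (κ + λ_i)^{2r} ∫₀^T e^{−2λ_i s} ds ≤ e^{2κT} · (T^{1−2r}/(1−2r)) · Σ_{i ∈ ι} b_i²; in particular the left-hand side is finite. -/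
open scoped ENNReal

lemma tc_pointwise (κ : ℝ) (hκ : 0 ≤ κ) (l : ℝ) (hl : 0 < κ + l) (r : ℝ) (hr0 : 0 ≤ r)
    (hr : r < 1 / 2) (T s : ℝ) (hs : 0 < s) (hsT : s ≤ T) :
    (κ + l) ^ (2 * r) * Real.exp (-2 * l * s) ≤ Real.exp (2 * κ * T) * s ^ (-(2 * r)) := by
  have hx : 0 < (κ + l) * s := mul_pos hl hs
  have h1 : ((κ + l) * s) ^ (2 * r) ≤ Real.exp (2 * ((κ + l) * s)) := by
    calc ((κ + l) * s) ^ (2 * r) ≤ (Real.exp ((κ + l) * s)) ^ (2 * r) := by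
          apply Real.rpow_le_rpow hx.le _ (by linarith)
          linarith [Real.add_one_le_exp ((κ + l) * s)]
      _ = Real.exp (((κ + l) * s) * (2 * r)) := (Real.exp_mul _ _).symm
      _ ≤ _ := Real.exp_le_exp.2 (by nlinarith)
  rw [Real.mul_rpow hl.le hs.le] at h1
  have hp : 0 < s ^ (2 * r) := Real.rpow_pos_of_pos hs _
  rw [Real.rpow_neg hs.le, ← div_eq_mul_inv, le_div_iff₀ hp]
  calc (κ + l) ^ (2 * r) * Real.exp (-2 * l * s) * s ^ (2 * r)
      = ((κ + l) ^ (2 * r) * s ^ (2 * r)) * Real.exp (-2 * l * s) := by ring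
    _ ≤ Real.exp (2 * ((κ + l) * s)) * Real.exp (-2 * l * s) := by gcongr
    _ = Real.exp (2 * κ * s) := by rw [← Real.exp_add]; ring_nf
    _ ≤ _ := Real.exp_le_exp.2 (by nlinarith)

lemma tc_integral (κ : ℝ) (hκ : 0 ≤ κ) (l : ℝ) (hl : 0 < κ + l) (r : ℝ) (hr0 : 0 ≤ r)
    (hr : r < 1 / 2) (T : ℝ) (hT : 0 < T) :
    (κ + l) ^ (2 * r) * (∫ s in (0 : ℝ)..T, Real.exp (-2 * l * s)) ≤
      Real.exp (2 * κ * T) * (T ^ (1 - 2 * r) / (1 - 2 * r)) := by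
  have h : ∫ s in (0 : ℝ)..T, s ^ (-(2 * r)) = T ^ (1 - 2 * r) / (1 - 2 * r) := by
    rw [integral_rpow (Or.inl (by linarith)), show -(2 * r) + 1 = 1 - 2 * r by ring,
      Real.zero_rpow (by linarith), sub_zero]
  rw [← h, ← intervalIntegral.integral_const_mul, ← intervalIntegral.integral_const_mul]
  apply intervalIntegral.integral_mono_on_of_le_Ioo hT.le
  · exact Continuous.intervalIntegrable (by fun_prop) _ _
  · exact (intervalIntegral.intervalIntegrable_rpow' (by linarith)).const_mul _
  · intro s hs
    exact tc_pointwise κ hκ l hl r hr0 hr T s hs.1 hs.2.le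

/-- **Trace class noise** (Section 5.5 of the paper).
Let `ι` be countable, `κ ≥ 0`, `(λ_i)` reals with `κ + λ_i > 0`, `(b_i)` reals with
`Σ_i b_i² < ∞`, `r ∈ [0,1/2)` and `T > 0`.  Then
`Σ_i b_i² (κ+λ_i)^{2r} ∫₀^T e^{−2λ_i s} ds ≤ e^{2κT} (T^{1−2r}/(1−2r)) Σ_i b_i²`;
in particular the left-hand side is finite. -/
theorem trace_class_fractional_power_bound
    {ι : Type*} [Countable ι] (κ : ℝ) (hκ : 0 ≤ κ)
    (lam : ι → ℝ) (hlam : ∀ i, 0 < κ + lam i)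
    (b : ι → ℝ) (hb : Summable fun i => b i ^ 2)
    (r : ℝ) (hr0 : 0 ≤ r) (hr : r < 1 / 2) (T : ℝ) (hT : 0 < T) :
    (∑' i, ENNReal.ofReal
        (b i ^ 2 * (κ + lam i) ^ (2 * r) * ∫ s in (0 : ℝ)..T, Real.exp (-2 * lam i * s)))
      ≤ ENNReal.ofReal
          (Real.exp (2 * κ * T) * (T ^ (1 - 2 * r) / (1 - 2 * r)) * ∑' i, b i ^ 2) ∧
    (∑' i, ENNReal.ofReal
        (b i ^ 2 * (κ + lam i) ^ (2 * r) * ∫ s in (0 : ℝ)..T, Real.exp (-2 * lam i * s)))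
      < ⊤ := by
  refine (fun h => ⟨h, h.trans_lt ENNReal.ofReal_lt_top⟩) ?_
  rw [← tsum_mul_left, ENNReal.ofReal_tsum_of_nonneg _ (hb.mul_left _)]
  · refine ENNReal.tsum_le_tsum fun i => ENNReal.ofReal_le_ofReal ?_
    rw [mul_assoc, mul_comm _ (b i ^ 2)]
    exact mul_le_mul_of_nonneg_left (tc_integral κ hκ (lam i) (hlam i) r hr0 hr T hT)
      (sq_nonneg _)
  · intro i
    have : 0 < 1 - 2 * r := by linarith
    positivity
end

section
/- Let γ ∈ (0,1) and δ ∈ (0,1/2]. Then every S-wood w ∈ SW′ contains at least one active tree (so that ord(w) is well defined), and for every real number R there exists an S-wood w ∈ SW′ with ord(w) ≥ R; that is, the iterated expansion of active nodes starting from w₀ produces S-woods of arbitrarily high order. -/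
/-- The four node labels `0`, `1`, `2`, `1*` of an S-tree. -/
inductive Lbl
  | zero | one | two | onestar
  deriving DecidableEq

/-- An S-tree (with 0-based nodes `0, …, len−1`): a length, a parent map (meaningful on
nodes `1, …, len−1`) and a labelling of the nodes (meaningful on nodes `0, …, len−1`). -/
structure STree where
  len : ℕ
  parent : ℕ → ℕ
  label : ℕ → Lbl

instance : Inhabited STree := ⟨⟨1, fun _ => 0, fun _ => Lbl.zero⟩⟩

/-- Well-formedness of an S-tree: at least one node, and the parent of every non-root
node is an earlier node. -/
def STree.WF (t : STree) : Prop :=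
  1 ≤ t.len ∧ ∀ k, 1 ≤ k → k < t.len → t.parent k < k

/-- An S-tree is active if some node carries the label `1*`. -/
def STree.IsActive (t : STree) : Prop :=
  ∃ j < t.len, t.label j = Lbl.onestar

/-- The tree `t` with the label of node `j` changed to `1`. -/
def relabel (t : STree) (j : ℕ) : STree :=
  ⟨t.len, t.parent, fun k => if k = j then Lbl.one else t.label k⟩

/-- The tree of length `l(t)+1` agreeing with `t` on the old nodes, whose new node has
parent `j` and carries the label `lab`. -/
def extend (t : STree) (j : ℕ) (lab : Lbl) : STree :=
  ⟨t.len + 1, fun k => if k = t.len then j else t.parent k,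
    fun k => if k = t.len then lab else t.label k⟩

/-- `(i, j)` is an active node of the wood `w`: `i` indexes a tree of `w`, `j` is a node
of that tree, and that node carries the label `1*`. -/
def ActiveNode (w : List STree) (i j : ℕ) : Prop :=
  i < w.length ∧ j < (w.getD i default).len ∧ (w.getD i default).label j = Lbl.onestar

/-- The expansion operator `E_{(i,j)}`: relabel node `j` of the `i`-th tree from `1*`
to `1` and append the three extended trees with new labels `0`, `1*` and `2`. -/
def Ewood (w : List STree) (i j : ℕ) : List STree :=
  w.set i (relabel (w.getD i default) j) ++
    [extend (w.getD i default) j Lbl.zero,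
     extend (w.getD i default) j Lbl.onestar,
     extend (w.getD i default) j Lbl.two]

/-- The initial wood `w₀`: three one-node trees carrying the labels `0`, `1*`, `2`. -/
def w0 : List STree :=
  [⟨1, fun _ => 0, fun _ => Lbl.zero⟩,
   ⟨1, fun _ => 0, fun _ => Lbl.onestar⟩,
   ⟨1, fun _ => 0, fun _ => Lbl.two⟩]

/-- The set `SW′` of woods obtained from `w₀` by iterated expansion of active nodes. -/
inductive InSWp : List STree → Prop
  | base : InSWp w0
  | step (w : List STree) (i j : ℕ) (hw : InSWp w) (h : ActiveNode w i j) :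
      InSWp (Ewood w i j)

/-- The order of an S-tree:
`ord(t) = l(t) + (γ−1)·#{nodes labelled 0} + (δ−1)·#{nodes labelled 2}`. -/
noncomputable def ordTree (γ δ : ℝ) (t : STree) : ℝ :=
  (t.len : ℝ)
    + (γ - 1) * (((Finset.range t.len).filter fun j => t.label j = Lbl.zero).card : ℝ)
    + (δ - 1) * (((Finset.range t.len).filter fun j => t.label j = Lbl.two).card : ℝ)

/-- The order of an S-wood: the minimum of the orders of its active trees. -/
noncomputable def ordWood (γ δ : ℝ) (w : List STree) : ℝ :=
  sInf {x : ℝ | ∃ t ∈ w, t.IsActive ∧ x = ordTree γ δ t}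

/-- Number of active nodes of a tree, counted only if its length is at most `n`. -/
def cnt (n : ℕ) (t : STree) : ℕ :=
  if t.len ≤ n then ((Finset.range t.len).filter fun j => t.label j = Lbl.onestar).card else 0

lemma sum_set_lt (f : STree → ℕ) (b : STree) : ∀ (w : List STree) (i : ℕ), i < w.length →
    f b < f (w.getD i default) → ((w.set i b).map f).sum < (w.map f).sum := by
  intro w
  induction w with
  | nil => intro i hi; simp at hi
  | cons a l ih =>
    intro i hi h
    cases i with
    | zero => simpa using h
    | succ k =>
      have := ih k (by simpa using hi) (by simpa using h)
      simpa using this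

lemma exists_active {w : List STree} (hw : InSWp w) : ∃ t ∈ w, t.IsActive := by
  cases hw with
  | base => exact ⟨⟨1, fun _ => 0, fun _ => Lbl.onestar⟩, by simp [w0], 0, Nat.zero_lt_one, rfl⟩
  | step w i j hw h =>
    refine ⟨extend (w.getD i default) j Lbl.onestar, by simp [Ewood],
      (w.getD i default).len, by simp [extend], by simp [extend]⟩

lemma cnt_relabel (n : ℕ) (t : STree) (j : ℕ) (hn : t.len ≤ n) (hj : j < t.len)
    (hl : t.label j = Lbl.onestar) : cnt n (relabel t j) < cnt n t := by
  have h1 : (relabel t j).len = t.len := rfl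
  unfold cnt
  rw [if_pos hn, h1, if_pos hn]
  apply Finset.card_lt_card
  rw [Finset.ssubset_iff_of_subset]
  · exact ⟨j, by simp [hj, hl], by rw [Finset.mem_filter]; simp [relabel]⟩
  · intro k hk
    rw [Finset.mem_filter] at hk ⊢
    simp only [relabel] at hk
    refine ⟨hk.1, ?_⟩
    have := hk.2
    split_ifs at this
    exact this

lemma cnt_big (n : ℕ) (t : STree) (h : n < t.len) : cnt n t = 0 := by
  unfold cnt
  rw [if_neg (by omega)]

lemma improve (n : ℕ) : ∀ (m : ℕ) (w : List STree), (w.map (cnt n)).sum = m → InSWp w →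
    (∀ t ∈ w, t.IsActive → n ≤ t.len) →
    ∃ w', InSWp w' ∧ ∀ t ∈ w', t.IsActive → n + 1 ≤ t.len := by
  intro m
  induction m using Nat.strong_induction_on with
  | _ m ih =>
    intro w hm hw hact
    by_cases hall : ∀ t ∈ w, t.IsActive → n + 1 ≤ t.len
    · exact ⟨w, hw, hall⟩
    push Not at hall
    obtain ⟨t, ht, ⟨j, hj, hl⟩, hlen⟩ := hall
    have hn : n ≤ t.len := hact t ht ⟨j, hj, hl⟩
    obtain ⟨i, hi, hti⟩ := List.getElem_of_mem ht
    have hg : w.getD i default = t := by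
      rw [List.getD_eq_getElem _ _ hi, hti]
    refine ih ((Ewood w i j).map (cnt n)).sum ?_ (Ewood w i j) rfl
      (InSWp.step w i j hw ⟨hi, by rw [hg]; exact hj, by rw [hg]; exact hl⟩) ?_
    · rw [← hm]
      have hs := sum_set_lt (cnt n) (relabel t j) w i hi
        (by rw [hg]; exact cnt_relabel n t j (by omega) hj hl)
      have he : ∀ lab, cnt n (extend t j lab) = 0 := fun lab =>
        cnt_big n _ (by simp only [extend]; omega)
      unfold Ewood
      rw [hg, List.map_append, List.sum_append]
      simpa [he] using hs
    · intro s hs ha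
      unfold Ewood at hs
      rw [hg, List.mem_append] at hs
      rcases hs with hs | hs
      · rcases List.mem_or_eq_of_mem_set hs with h | h
        · exact hact s h ha
        · rw [h]; exact hn
      · simp only [List.mem_cons, List.not_mem_nil, or_false] at hs
        rcases hs with h | h | h <;> rw [h] <;> simp only [extend] <;> omega

lemma exists_long (n : ℕ) : ∃ w, InSWp w ∧ ∀ t ∈ w, t.IsActive → n ≤ t.len := by
  induction n with
  | zero => exact ⟨w0, InSWp.base, fun _ _ _ => Nat.zero_le _⟩
  | succ n ih =>
    obtain ⟨w, hw, h⟩ := ih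
    exact improve n _ w rfl hw h

lemma ord_lower (γ δ c : ℝ) (hc : c ≤ 1) (h1 : c ≤ γ) (h2 : c ≤ δ) (t : STree) :
    c * t.len ≤ ordTree γ δ t := by
  unfold ordTree
  have hd : ((Finset.range t.len).filter fun j => t.label j = Lbl.zero).card +
      ((Finset.range t.len).filter fun j => t.label j = Lbl.two).card ≤ t.len := by
    rw [← Finset.card_union_of_disjoint]
    · refine (Finset.card_le_card (t := Finset.range t.len) ?_).trans (by simp)
      exact Finset.union_subset (Finset.filter_subset _ _) (Finset.filter_subset _ _)
    · rw [Finset.disjoint_filter]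
      intro x _ h h'
      rw [h] at h'
      cases h'
  generalize ((Finset.range t.len).filter fun j => t.label j = Lbl.zero).card = a at hd ⊢
  generalize ((Finset.range t.len).filter fun j => t.label j = Lbl.two).card = b at hd ⊢
  have hd' : (a : ℝ) + b ≤ t.len := by exact_mod_cast hd
  have ha : (0 : ℝ) ≤ a := Nat.cast_nonneg _
  have hb : (0 : ℝ) ≤ b := Nat.cast_nonneg _
  nlinarith [mul_nonneg (sub_nonneg.2 hc) (sub_nonneg.2 hd'),
    mul_nonneg (sub_nonneg.2 h1) ha, mul_nonneg (sub_nonneg.2 h2) hb]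

/-- **Woods of arbitrarily high order** (Section 4 of the paper).
Let `γ ∈ (0,1)` and `δ ∈ (0,1/2]`.  Every wood in `SW′` contains an active tree (so its
order is well defined), and for every real `R` there is a wood `w ∈ SW′` with
`ord(w) ≥ R`. -/
theorem swp_arbitrarily_high_order (γ δ : ℝ)
    (hγ0 : 0 < γ) (hγ1 : γ < 1) (hδ0 : 0 < δ) (hδ2 : δ ≤ 1 / 2) :
    (∀ w, InSWp w → ∃ t ∈ w, t.IsActive) ∧
    (∀ R : ℝ, ∃ w, InSWp w ∧ R ≤ ordWood γ δ w) := by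
  refine ⟨fun w hw => exists_active hw, fun R => ?_⟩
  have hc : 0 < min γ δ := lt_min hγ0 hδ0
  obtain ⟨n, hn⟩ := exists_nat_ge (R / min γ δ)
  obtain ⟨w, hw, h⟩ := exists_long n
  refine ⟨w, hw, ?_⟩
  obtain ⟨t, ht, ha⟩ := exists_active hw
  refine le_csInf ⟨_, t, ht, ha, rfl⟩ ?_
  rintro x ⟨s, hs, hsa, rfl⟩
  refine le_trans ?_ (ord_lower γ δ (min γ δ) ((min_le_left _ _).trans hγ1.le)
    (min_le_left _ _) (min_le_right _ _) s)
  rw [div_le_iff₀ hc] at hn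
  have hl : (n : ℝ) ≤ s.len := by exact_mod_cast h s hs hsa
  nlinarith
end
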